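/- Identity Principle: let Ω ⊆ ℍ be a (1,3)-slice domain and let f, g : Ω → ℍ be (1,3)-regular functions. If there exist J₀ ∈ S¹ and a subset S of Ω ∩ ℝ³_{J₀} with nonempty interior relative to ℝ³_{J₀} such that f = g on S, then f = g throughout Ω. -/

import Mathlib

open Quaternion

noncomputable section

/-- The real quaternions. -/
abbrev H : Type := Quaternion ℝ

/-- The imaginary unit `i`. -/
def qi : H := ⟨0, 1, 0, 0⟩
/-- The imaginary unit `j`. -/
def qj : H := ⟨0, 0, 1, 0⟩
/-- The imaginary unit `k`. -/
def qk : H := ⟨0, 0, 0, 1⟩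

/-- `S¹`: the circle of unit quaternions in the plane `jℝ + kℝ`. -/
def S1 : Set H := {J : H | J.re = 0 ∧ J.imI = 0 ∧ J.imJ ^ 2 + J.imK ^ 2 = 1}

/-- The subset `ℂ = ℝ + iℝ` of `ℍ` (the mirror). -/
def Cset : Set H := {x : H | x.imJ = 0 ∧ x.imK = 0}

/-- Coordinates `(x₀,x₁,β) ↦ x₀ + i x₁ + β J` for the hyperplane `ℝ³_J`. -/
def psi (J : H) (u : ℝ × ℝ × ℝ) : H := (u.1 : H) + u.2.1 • qi + u.2.2 • J

/-- The hyperplane `ℝ³_J = Span_ℝ(1, i, J)` of `ℍ`, as the range of `psi J`. -/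
def hplane (J : H) : Set H := Set.range (psi J)

/-- `f` is `J`-monogenic on the `J`-hplane of `Ω`: in the coordinates `(x₀,x₁,β)`,
the restriction of `f` to `Ω ∩ ℝ³_J` is real-differentiable and satisfies
`∂_{x₀}f + i·∂_{x₁}f + J·∂_βf = 0`. -/
def JMonogenicOn (J : H) (f : H → H) (Ω : Set H) : Prop :=
  ∀ u : ℝ × ℝ × ℝ, psi J u ∈ Ω →
    DifferentiableAt ℝ (fun v => f (psi J v)) u ∧
    fderiv ℝ (fun v => f (psi J v)) u (1, 0, 0)
      + qi * fderiv ℝ (fun v => f (psi J v)) u (0, 1, 0)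
      + J * fderiv ℝ (fun v => f (psi J v)) u (0, 0, 1) = 0

/-- `f` is `(1,3)`-regular on `Ω`: for every `J ∈ S¹`, the restriction of `f`
to `Ω ∩ ℝ³_J` is `J`-monogenic. -/
def Regular13 (f : H → H) (Ω : Set H) : Prop :=
  ∀ J ∈ S1, JMonogenicOn J f Ω

/-- `Ω` is a `(1,3)`-slice domain: a domain intersecting the mirror `ℂ`, whose
`J`-slices `Ω ∩ ℝ³_J` are all connected. -/
def IsSliceDomain13 (Ω : Set H) : Prop :=
  IsOpen Ω ∧ IsConnected Ω ∧ (Ω ∩ Cset).Nonempty ∧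
  ∀ J ∈ S1, IsConnected (Ω ∩ hplane J)

open MeasureTheory Set Filter Topology Metric
open scoped ContDiff

/-- The Clifford relations for a triple of quaternions: the associated Dirac symbol squares to the
Euclidean norm. -/
def IsCliffordFrame (e : Fin 3 → H) : Prop :=
  ∀ z : Fin 3 → ℝ, (∑ m, z m • star (e m)) * (∑ k, z k • e k) = ((∑ i, z i ^ 2 : ℝ) : H)

/-- Differentiable solutions on `U` of the Dirac equation `∑ k, e k * ∂_k h = 0`. -/
def Monogenic (e : Fin 3 → H) (h : (Fin 3 → ℝ) → H) (U : Set (Fin 3 → ℝ)) : Prop :=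
  ∀ x ∈ U, DifferentiableAt ℝ h x ∧ ∑ k, e k * fderiv ℝ h x (Pi.single k 1) = 0

lemma IsCliffordFrame.star_mul_self {e : Fin 3 → H} (he : IsCliffordFrame e) (m : Fin 3) :
    star (e m) * e m = 1 := by
  have := he (Pi.single m 1)
  simpa [Pi.single_apply, ite_smul] using this

lemma Monogenic.mono {e : Fin 3 → H} {h : (Fin 3 → ℝ) → H} {U W : Set (Fin 3 → ℝ)}
    (hh : Monogenic e h U) (hWU : W ⊆ U) : Monogenic e h W :=
  fun x hx => hh x (hWU hx)

lemma Monogenic.continuousOn {e : Fin 3 → H} {h : (Fin 3 → ℝ) → H} {U : Set (Fin 3 → ℝ)}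
    (hh : Monogenic e h U) : ContinuousOn h U :=
  fun x hx => (hh x hx).1.continuousAt.continuousWithinAt

lemma hasFDerivAt_comp_affine {h : (Fin 3 → ℝ) → H} {a z : Fin 3 → ℝ} {r : ℝ}
    (hd : DifferentiableAt ℝ h (a + r • z)) :
    HasFDerivAt (fun y => h (a + r • y)) (r • fderiv ℝ h (a + r • z)) z := by
  have h1 : HasFDerivAt (fun y : Fin 3 → ℝ => a + r • y)
      (r • ContinuousLinearMap.id ℝ (Fin 3 → ℝ)) z :=
    ((hasFDerivAt_id z).const_smul r).const_add a
  exact (hd.hasFDerivAt.comp z h1).congr_fderiv (by ext1 v; simp)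

lemma Monogenic.comp_affine {e : Fin 3 → H} {h : (Fin 3 → ℝ) → H} {U : Set (Fin 3 → ℝ)}
    (hh : Monogenic e h U) (a : Fin 3 → ℝ) (r : ℝ) :
    Monogenic e (fun z => h (a + r • z)) {z | a + r • z ∈ U} := by
  intro z hz
  obtain ⟨hd, hD⟩ := hh _ hz
  have h2 := hasFDerivAt_comp_affine hd
  refine ⟨h2.differentiableAt, ?_⟩
  rw [h2.fderiv]
  simp only [smul_apply, mul_smul_comm, ← Finset.smul_sum, hD, smul_zero]

lemma mem_Icc_neg_one_one_iff {z : Fin 3 → ℝ} : z ∈ Icc (-1 : Fin 3 → ℝ) 1 ↔ ‖z‖ ≤ 1 := by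
  rw [pi_norm_le_iff_of_nonneg zero_le_one]
  simp only [Real.norm_eq_abs, abs_le, mem_Icc, Pi.le_def, forall_and, Pi.neg_apply, Pi.one_apply]

/-- Weak form of the Dirac equation on the unit cube. -/
lemma Monogenic.integral_test_eq_zero {e : Fin 3 → H} {h : (Fin 3 → ℝ) → H}
    {U : Set (Fin 3 → ℝ)} (hh : Monogenic e h U) (hU : Icc (-1) 1 ⊆ U) {η : (Fin 3 → ℝ) → ℝ}
    (hη : ContDiff ℝ 1 η) (hη0 : ∀ z k, |z k| = 1 → η z = 0) :
    ∫ z in Icc (-1 : Fin 3 → ℝ) 1, ∑ k, fderiv ℝ η z (Pi.single k 1) • (e k * h z) = 0 := by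
  have hcont : ContinuousOn h (Icc (-1) 1) := hh.continuousOn.mono hU
  have hηd := hη.differentiable one_ne_zero
  have hη' := hη.continuous_fderiv one_ne_zero
  have hsub : (Set.pi univ fun i : Fin 3 => Ioo ((-1 : Fin 3 → ℝ) i) ((1 : Fin 3 → ℝ) i)) ⊆
      Icc (-1) 1 := fun z hz => ⟨fun i => (hz i trivial).1.le, fun i => (hz i trivial).2.le⟩
  let f' : Fin 3 → (Fin 3 → ℝ) → (Fin 3 → ℝ) →L[ℝ] H := fun k z =>
    η z • (ContinuousLinearMap.mul ℝ H (e k)).comp (fderiv ℝ h z) +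
      (fderiv ℝ η z).smulRight (e k * h z)
  have hdiv : ∀ z ∈ Icc (-1 : Fin 3 → ℝ) 1, ∑ k, f' k z (Pi.single k 1) =
      ∑ k, fderiv ℝ η z (Pi.single k 1) • (e k * h z) := by
    intro z hz
    have := (hh z (hU hz)).2
    simp only [f', add_apply, smul_apply,
      ContinuousLinearMap.comp_apply, ContinuousLinearMap.mul_apply',
      ContinuousLinearMap.smulRight_apply, Finset.sum_add_distrib, ← Finset.smul_sum, this,
      smul_zero, zero_add]
  have key := integral_divergence_of_hasFDerivAt_off_countable' (n := 2) (-1) 1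
    (fun i => by norm_num) (fun k z => η z • (e k * h z)) f' ∅ countable_empty
    (fun k => hη.continuous.continuousOn.smul (continuousOn_const.mul hcont))
    (fun z hz k => by
      have hd := (hh z (hU (hsub hz.1))).1.hasFDerivAt
      exact (hηd z).hasFDerivAt.smul (((ContinuousLinearMap.mul ℝ H (e k)).hasFDerivAt).comp z hd))
    (by
      refine IntegrableOn.congr_fun (f := fun z => ∑ k, fderiv ℝ η z (Pi.single k 1) • (e k * h z))
        ?_ (fun z hz => (hdiv z hz).symm) measurableSet_Icc
      refine ContinuousOn.integrableOn_compact isCompact_Icc ?_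
      exact continuousOn_finsetSum _ fun k _ =>
        (hη'.clm_apply continuous_const).continuousOn.smul (continuousOn_const.mul hcont))
  rw [← setIntegral_congr_fun measurableSet_Icc hdiv, key]
  refine Finset.sum_eq_zero fun i _ => ?_
  have h1 : ∀ x : Fin 2 → ℝ, η (i.insertNth ((1 : Fin 3 → ℝ) i) x) = 0 :=
    fun x => hη0 _ i (by simp)
  have h2 : ∀ x : Fin 2 → ℝ, η (i.insertNth ((-1 : Fin 3 → ℝ) i) x) = 0 :=
    fun x => hη0 _ i (by simp)
  simp only [h1, h2, zero_smul, sub_self]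

lemma hasFDerivAt_sum_sq (z : Fin 3 → ℝ) :
    HasFDerivAt (fun z : Fin 3 → ℝ => ∑ i, z i ^ 2)
      (∑ i, (2 * z i) • ContinuousLinearMap.proj (R := ℝ) (φ := fun _ : Fin 3 => ℝ) i) z := by
  refine HasFDerivAt.fun_sum fun i _ => ?_
  simpa using (hasFDerivAt_apply (𝕜 := ℝ) (F' := fun _ : Fin 3 => ℝ) i z).pow 2

/-- The components of a monogenic function are orthogonal to the divergence of `g (|z|²) z`
for every profile `g` vanishing on `[1, ∞)`. -/
lemma Monogenic.integral_radial_eq_zero {e : Fin 3 → H} (he : IsCliffordFrame e)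
    {h : (Fin 3 → ℝ) → H} {U : Set (Fin 3 → ℝ)} (hh : Monogenic e h U) (hU : Icc (-1) 1 ⊆ U)
    {g : ℝ → ℝ} (hg : ContDiff ℝ 1 g) (hg0 : ∀ s, 1 ≤ s → g s = 0) :
    ∫ z in Icc (-1 : Fin 3 → ℝ) 1,
      (3 * g (∑ i, z i ^ 2) + 2 * (∑ i, z i ^ 2) * deriv g (∑ i, z i ^ 2)) • h z = 0 := by
  have hcont : ContinuousOn h (Icc (-1) 1) := hh.continuousOn.mono hU
  let η : Fin 3 → (Fin 3 → ℝ) → ℝ := fun m z => z m * g (∑ i, z i ^ 2)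
  have hη : ∀ m, ContDiff ℝ 1 (η m) := fun m => by fun_prop
  have hη' : ∀ m z k, fderiv ℝ (η m) z (Pi.single k 1) =
      (if m = k then g (∑ i, z i ^ 2) else 0) + 2 * deriv g (∑ i, z i ^ 2) * (z m * z k) := by
    intro m z k
    have h1 := ((hg.differentiable one_ne_zero (∑ i, z i ^ 2)).hasDerivAt).comp_hasFDerivAt z
      (hasFDerivAt_sum_sq z)
    have h2 := (hasFDerivAt_apply (𝕜 := ℝ) (F' := fun _ : Fin 3 => ℝ) m z).mul h1
    rw [HasFDerivAt.fderiv (f := η m) h2]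
    simp [Pi.single_apply]
    split_ifs <;> ring
  have hint : ∀ m, ∫ z in Icc (-1 : Fin 3 → ℝ) 1,
      star (e m) * ∑ k, fderiv ℝ (η m) z (Pi.single k 1) • (e k * h z) = 0 := by
    intro m
    rw [integral_const_mul_of_integrable, hh.integral_test_eq_zero hU (hη m), mul_zero]
    · intro z k hz
      have : 1 ≤ ∑ i, z i ^ 2 := by
        have := Finset.single_le_sum (f := fun i => z i ^ 2) (fun i _ => sq_nonneg _)
          (Finset.mem_univ k)
        simpa [← sq_abs (z k), hz] using this
      simp [η, hg0 _ this]
    · exact ContinuousOn.integrableOn_compact isCompact_Icc <|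
        continuousOn_finsetSum _ fun k _ => (((hη m).continuous_fderiv one_ne_zero).clm_apply
          continuous_const).continuousOn.smul (continuousOn_const.mul hcont)
  have hsum : ∀ z, (3 * g (∑ i, z i ^ 2) + 2 * (∑ i, z i ^ 2) * deriv g (∑ i, z i ^ 2)) • h z =
      ∑ m, star (e m) * ∑ k, fderiv ℝ (η m) z (Pi.single k 1) • (e k * h z) := by
    intro z
    set s := ∑ i, z i ^ 2 with hs
    have h1 := he z
    rw [← hs] at h1
    have h2 : ∑ m, star (e m) * ∑ k, (z m * z k) • (e k * h z) = s • h z := by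
      rw [← Quaternion.coe_mul_eq_smul, ← h1, Finset.sum_mul_sum, Finset.sum_mul]
      refine Finset.sum_congr rfl fun m _ => ?_
      rw [Finset.mul_sum, Finset.sum_mul]
      refine Finset.sum_congr rfl fun k _ => ?_
      simp only [smul_mul_assoc, mul_smul_comm, smul_smul, mul_assoc]
      rw [mul_comm]
    simp only [hη', ← hs, add_smul, ite_smul, zero_smul, Finset.sum_add_distrib,
      Finset.sum_ite_eq, Finset.mem_univ, if_true, mul_add]
    simp only [mul_smul_comm, he.star_mul_self, ← mul_assoc, one_mul]
    have h3 : ∑ m, star (e m) * ∑ k, (2 * deriv g s * z m * z k) • (e k * h z) =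
        (2 * deriv g s * s) • h z := by
      rw [mul_smul, ← h2]
      simp only [Finset.smul_sum, ← mul_smul_comm, smul_smul, mul_assoc]
    rw [h3, Finset.sum_const, Finset.card_univ, Fintype.card_fin]
    module
  simp only [hsum]
  rw [integral_finsetSum]
  · exact Finset.sum_eq_zero fun m _ => hint m
  · intro m _
    exact ContinuousOn.integrableOn_compact isCompact_Icc <| continuousOn_const.mul <|
        continuousOn_finsetSum _ fun k _ => (((hη m).continuous_fderiv one_ne_zero).clm_apply
          continuous_const).continuousOn.smul (continuousOn_const.mul hcont)

/-- A smooth function on the line that is positive before `1` and vanishes from `1` on. -/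
def cutoff (s : ℝ) : ℝ := Real.smoothTransition (1 - s)

lemma contDiff_cutoff {n : ℕ∞} : ContDiff ℝ n cutoff :=
  Real.smoothTransition.contDiff.comp (contDiff_const.sub contDiff_id)

lemma cutoff_eq_zero {s : ℝ} (hs : 1 ≤ s) : cutoff s = 0 :=
  Real.smoothTransition.zero_of_nonpos (by linarith)

lemma cutoff_nonneg (s : ℝ) : 0 ≤ cutoff s := Real.smoothTransition.nonneg _

lemma deriv_cutoff_eq_zero {s : ℝ} (hs : 1 ≤ s) : deriv cutoff s = 0 :=
  IsLocalMin.deriv_eq_zero <| Eventually.of_forall fun _ =>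
    (cutoff_eq_zero hs).trans_le (cutoff_nonneg _)

/-- A smooth radial bump function supported in the unit cube. -/
def radialBump (z : Fin 3 → ℝ) : ℝ := cutoff (∑ i, z i ^ 2)

lemma contDiff_radialBump {n : ℕ∞} : ContDiff ℝ n radialBump :=
  contDiff_cutoff.comp (by fun_prop)

lemma one_le_sum_sq {z : Fin 3 → ℝ} (hz : 1 ≤ ‖z‖) : 1 ≤ ∑ i, z i ^ 2 := by
  by_contra! h
  refine absurd hz (not_le.2 ((pi_norm_lt_iff one_pos).2 fun i => ?_))
  have := Finset.single_le_sum (f := fun i => z i ^ 2) (fun i _ => sq_nonneg _)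
    (Finset.mem_univ i)
  rw [Real.norm_eq_abs, ← sq_lt_one_iff_abs_lt_one]
  exact this.trans_lt h

lemma radialBump_eq_zero {z : Fin 3 → ℝ} (hz : 1 ≤ ‖z‖) : radialBump z = 0 :=
  cutoff_eq_zero (one_le_sum_sq hz)

lemma tsupport_radialBump_subset : tsupport radialBump ⊆ closedBall 0 1 := by
  refine closure_minimal (fun z hz => ?_) isClosed_closedBall
  rw [mem_closedBall_zero_iff]
  by_contra! h
  exact hz (radialBump_eq_zero h.le)

lemma hasCompactSupport_radialBump : HasCompactSupport radialBump :=
  (isCompact_closedBall 0 1).of_isClosed_subset (isClosed_tsupport _) tsupport_radialBump_subset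

lemma integral_radialBump_pos : 0 < ∫ z, radialBump z :=
  (contDiff_radialBump (n := 0)).continuous.integral_pos_of_hasCompactSupport_nonneg_nonzero
    hasCompactSupport_radialBump (fun _ => cutoff_nonneg _)
    (x := 0) (Real.smoothTransition.pos_of_pos (by simp)).ne'

lemma exists_bound_cutoff_deriv :
    ∃ C, ∀ s, 0 ≤ s → |3 * cutoff s + 2 * s * deriv cutoff s| ≤ C := by
  have hc : Continuous fun s => 3 * cutoff s + 2 * s * deriv cutoff s := by
    have h1 := (contDiff_cutoff (n := 1)).continuous_deriv le_rfl
    have h2 := (contDiff_cutoff (n := 1)).continuous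
    fun_prop
  obtain ⟨C, hC⟩ := (isCompact_Icc (a := (0 : ℝ)) (b := 1)).exists_bound_of_continuousOn
    hc.continuousOn
  refine ⟨C, fun s hs => ?_⟩
  rcases le_or_gt s 1 with h | h
  · exact hC s ⟨hs, h⟩
  · rw [cutoff_eq_zero h.le, deriv_cutoff_eq_zero h.le]
    simpa using (norm_nonneg _).trans (hC 0 (by simp))

lemma integral_radial_comp_smul (w : ℝ → ℝ) (k : (Fin 3 → ℝ) → H) {t : ℝ} (ht : 0 < t) :
    ∫ z, w (∑ i, z i ^ 2) • k (t • z) =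
      (t ^ 3)⁻¹ • ∫ y, w ((∑ i, y i ^ 2) * (t ^ 2)⁻¹) • k y := by
  have := Measure.integral_comp_smul (volume : Measure (Fin 3 → ℝ))
    (fun y => w ((∑ i, y i ^ 2) * (t ^ 2)⁻¹) • k y) t
  rw [Module.finrank_fin_fun, abs_of_pos (by positivity)] at this
  rw [← this]
  congr! 4 with z
  simp only [Pi.smul_apply, smul_eq_mul, mul_pow, ← Finset.mul_sum]
  field_simp

lemma hasDerivAt_scaled_cutoff (q : ℝ) {t : ℝ} (ht : 0 < t) :
    HasDerivAt (fun t => (t ^ 3)⁻¹ * cutoff (q * (t ^ 2)⁻¹))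
      (-(t ^ 4)⁻¹ * (3 * cutoff (q * (t ^ 2)⁻¹) +
        2 * (q * (t ^ 2)⁻¹) * deriv cutoff (q * (t ^ 2)⁻¹))) t := by
  have h3 := (hasDerivAt_pow 3 t).inv (by positivity)
  have h2 := ((hasDerivAt_pow 2 t).inv (by positivity)).const_mul q
  have hc := (((contDiff_cutoff (n := 1)).differentiable one_ne_zero
    (q * (t ^ 2)⁻¹)).hasDerivAt).comp t h2
  refine (h3.mul hc).congr_deriv ?_
  simp only [Function.comp, Pi.inv_apply]
  field_simp
  ring

/-- The mean value property over the unit cube. -/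
lemma Monogenic.integral_radialBump_smul {e : Fin 3 → H} (he : IsCliffordFrame e)
    {h : (Fin 3 → ℝ) → H} {U : Set (Fin 3 → ℝ)} (hh : Monogenic e h U) (hU : closedBall 0 1 ⊆ U) :
    ∫ z, radialBump z • h z = (∫ z, radialBump z) • h 0 := by
  have hball : Icc (-1 : Fin 3 → ℝ) 1 = closedBall 0 1 := by
    ext z; rw [mem_Icc_neg_one_one_iff, mem_closedBall_zero_iff]
  have hcont : ContinuousOn h (closedBall 0 1) := hh.continuousOn.mono hU
  obtain ⟨M, hM⟩ := (isCompact_closedBall (0 : Fin 3 → ℝ) 1).exists_bound_of_continuousOn hcont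
  have hM0 : 0 ≤ M := (norm_nonneg _).trans (hM 0 (by simp))
  set k : (Fin 3 → ℝ) → H := (closedBall 0 1).indicator h with hk
  have hkint : Integrable k :=
    (hcont.integrableOn_compact (isCompact_closedBall _ _)).integrable_indicator
      measurableSet_closedBall
  have hkM : ∀ z, ‖k z‖ ≤ M := fun z => by
    by_cases hz : z ∈ closedBall (0 : Fin 3 → ℝ) 1
    · simpa [hk, indicator_of_mem hz] using hM z hz
    · simpa [hk, indicator_of_notMem hz] using hM0
  let G : ℝ → ℝ := fun s => 3 * cutoff s + 2 * s * deriv cutoff s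
  have hGc : Continuous G := by
    have h1 := (contDiff_cutoff (n := 1)).continuous_deriv le_rfl
    have h2 := (contDiff_cutoff (n := 1)).continuous
    fun_prop
  obtain ⟨C, hC⟩ := exists_bound_cutoff_deriv
  have hcut : Continuous cutoff := (contDiff_cutoff (n := 0)).continuous
  let φ : ℝ → H := fun t => ∫ y, ((t ^ 3)⁻¹ * cutoff ((∑ i, y i ^ 2) * (t ^ 2)⁻¹)) • k y
  have hφ : ∀ t, 0 < t → HasDerivAt φ
      (∫ y, (-(t ^ 4)⁻¹ * G ((∑ i, y i ^ 2) * (t ^ 2)⁻¹)) • k y) t := by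
    intro t ht
    have hcoef : ∀ t : ℝ, Continuous fun y : Fin 3 → ℝ =>
        (t ^ 3)⁻¹ * cutoff ((∑ i, y i ^ 2) * (t ^ 2)⁻¹) := fun t => by fun_prop
    refine (hasDerivAt_integral_of_dominated_loc_of_deriv_le (s := Ioi (t / 2))
      (F := fun t y => ((t ^ 3)⁻¹ * cutoff ((∑ i, y i ^ 2) * (t ^ 2)⁻¹)) • k y)
      (F' := fun t y => (-(t ^ 4)⁻¹ * G ((∑ i, y i ^ 2) * (t ^ 2)⁻¹)) • k y)
      (bound := fun y => ((t / 2) ^ 4)⁻¹ * C * ‖k y‖) (Ioi_mem_nhds (half_lt_self ht))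
      (Eventually.of_forall fun s => (hcoef s).aestronglyMeasurable.smul
        hkint.aestronglyMeasurable) ?_ ?_ ?_ (hkint.norm.const_mul _) ?_).2
    · refine hkint.bdd_smul ((t ^ 3)⁻¹) (hcoef t).aestronglyMeasurable
        (Eventually.of_forall fun y => ?_)
      rw [norm_mul, Real.norm_of_nonneg (by positivity)]
      refine mul_le_of_le_one_right (by positivity) ?_
      rw [Real.norm_of_nonneg (cutoff_nonneg _)]
      exact Real.smoothTransition.le_one _
    · have hcoef' : Continuous fun y : Fin 3 → ℝ =>
          -(t ^ 4)⁻¹ * G ((∑ i, y i ^ 2) * (t ^ 2)⁻¹) := by fun_prop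
      exact hcoef'.aestronglyMeasurable.smul hkint.aestronglyMeasurable
    · refine Eventually.of_forall fun y s hs => ?_
      have hs' : t / 2 < s := hs
      rw [norm_smul, norm_mul, norm_neg, Real.norm_of_nonneg (by positivity)]
      gcongr
      exact hC _ (by positivity)
    · refine Eventually.of_forall fun y s hs => ?_
      have hs' : t / 2 < s := hs
      exact (hasDerivAt_scaled_cutoff _ (by linarith)).smul_const _
  have hφ0 : ∀ t, 0 < t → t ≤ 1 → HasDerivAt φ 0 t := by
    intro t ht ht1
    have hsmul : ∀ z ∈ Icc (-1 : Fin 3 → ℝ) 1, t • z ∈ closedBall (0 : Fin 3 → ℝ) 1 := by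
      intro z hz
      rw [hball, mem_closedBall_zero_iff] at hz
      rw [mem_closedBall_zero_iff, norm_smul, Real.norm_of_nonneg ht.le]
      exact mul_le_one₀ ht1 (norm_nonneg _) hz
    convert hφ t ht using 1
    simp only [mul_smul, integral_smul]
    have h1 := integral_radial_comp_smul G k ht
    have h2 := ((hh.comp_affine 0 t).integral_radial_eq_zero he
      (fun z hz => hU ((zero_add (t • z)).symm ▸ hsmul z hz))
      (contDiff_cutoff (n := 1)) (fun s => cutoff_eq_zero))
    have h3 : ∫ z, G (∑ i, z i ^ 2) • k (t • z) = 0 := by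
      rw [← h2, ← integral_indicator measurableSet_Icc]
      refine integral_congr_ae (Eventually.of_forall fun z => ?_)
      by_cases hz : z ∈ Icc (-1 : Fin 3 → ℝ) 1
      · simp [indicator_of_mem hz, G, hk, indicator_of_mem (hsmul z hz)]
      · have hz1 : 1 ≤ ‖z‖ := (not_le.1 fun hz' => hz (mem_Icc_neg_one_one_iff.2 hz')).le
        simp [indicator_of_notMem hz, G, cutoff_eq_zero (one_le_sum_sq hz1),
          deriv_cutoff_eq_zero (one_le_sum_sq hz1)]
    rw [h3, eq_comm, smul_eq_zero] at h1
    rw [h1.resolve_left (by positivity), smul_zero]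
  have hφeq : ∀ t, 0 < t → φ t = ∫ z, radialBump z • k (t • z) := by
    intro t ht
    simp only [φ, mul_smul, integral_smul, radialBump, integral_radial_comp_smul cutoff k ht]
  have hconst : ∀ t ∈ Ioc (0 : ℝ) 1, φ t = φ 1 := fun t ht =>
    (constant_of_has_deriv_right_zero (a := t) (b := 1)
      (fun s hs => (hφ s (ht.1.trans_le hs.1)).continuousAt.continuousWithinAt)
      (fun s hs => (hφ0 s (ht.1.trans_le hs.1) hs.2.le).hasDerivWithinAt) 1 ⟨ht.2, le_rfl⟩).symm
  have hlim : Tendsto (fun t : ℝ => ∫ z, radialBump z • k (t • z)) (𝓝[>] 0)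
      (𝓝 (∫ z, radialBump z • h 0)) := by
    have hbint : Integrable radialBump :=
      (contDiff_radialBump (n := 0)).continuous.integrable_of_hasCompactSupport
        hasCompactSupport_radialBump
    refine tendsto_integral_filter_of_dominated_convergence (fun z => ‖radialBump z‖ * M) ?_ ?_
      (hbint.norm.mul_const _) ?_
    · filter_upwards [self_mem_nhdsWithin] with t ht
      exact hbint.aestronglyMeasurable.smul
        (hkint.comp_smul (ne_of_gt ht)).aestronglyMeasurable
    · refine Eventually.of_forall fun t => Eventually.of_forall fun z => ?_
      rw [norm_smul]
      gcongr
      exact hkM _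
    · refine Eventually.of_forall fun z => ?_
      have hk0 : ContinuousAt k 0 := by
        have : k =ᶠ[𝓝 0] h := by
          filter_upwards [closedBall_mem_nhds (0 : Fin 3 → ℝ) one_pos] with y hy
            using indicator_of_mem hy _
        exact (hcont.continuousAt (closedBall_mem_nhds _ one_pos)).congr this.symm
      have hk00 : k 0 = h 0 := indicator_of_mem (by simp) _
      refine Tendsto.const_smul ?_ _
      rw [← hk00]
      refine hk0.tendsto.comp (tendsto_nhdsWithin_of_tendsto_nhds ?_)
      have : Continuous fun t : ℝ => t • z := by fun_prop
      simpa using this.tendsto 0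
  have hlim' : Tendsto (fun t : ℝ => ∫ z, radialBump z • k (t • z)) (𝓝[>] 0) (𝓝 (φ 1)) := by
    refine tendsto_const_nhds.congr' ?_
    filter_upwards [Ioc_mem_nhdsGT one_pos] with t ht
    rw [← hφeq t ht.1, hconst t ht]
  have := tendsto_nhds_unique hlim' hlim
  rw [hφeq 1 one_pos, integral_smul_const] at this
  rw [← this]
  refine integral_congr_ae (Eventually.of_forall fun z => ?_)
  by_cases hz : z ∈ closedBall (0 : Fin 3 → ℝ) 1
  · simp [hk, indicator_of_mem hz]
  · rw [mem_closedBall_zero_iff, not_le] at hz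
    simp [radialBump_eq_zero hz.le]

open scoped Convolution in
/-- Monogenic functions are smooth. -/
lemma Monogenic.contDiffAt {e : Fin 3 → H} (he : IsCliffordFrame e) {h : (Fin 3 → ℝ) → H}
    {U : Set (Fin 3 → ℝ)} (hU : IsOpen U) (hh : Monogenic e h U) {x : Fin 3 → ℝ} (hx : x ∈ U) :
    ContDiffAt ℝ ∞ h x := by
  obtain ⟨ε, hε, hεU⟩ := Metric.isOpen_iff.1 hU x hx
  obtain ⟨r, hr, hrε⟩ : ∃ r, 0 < r ∧ r * 2 < ε := ⟨ε / 3, by positivity, by linarith⟩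
  set k : (Fin 3 → ℝ) → H := fun w => h (x + r • w) with hk
  have hmono := hh.comp_affine x r
  have hsub : closedBall 0 2 ⊆ {z | x + r • z ∈ U} := by
    intro z hz
    rw [mem_closedBall_zero_iff] at hz
    refine hεU ?_
    rw [mem_ball, dist_self_add_left, norm_smul, Real.norm_of_nonneg hr.le]
    exact (mul_le_mul_of_nonneg_left hz hr.le).trans_lt hrε
  set K : (Fin 3 → ℝ) → H := (closedBall 0 2).indicator k with hK
  have hKint : LocallyIntegrable K :=
    (((hmono.continuousOn.mono hsub).integrableOn_compact
      (isCompact_closedBall _ _)).integrable_indicator measurableSet_closedBall).locallyIntegrable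
  have hsmooth : ContDiff ℝ ∞ (radialBump ⋆[ContinuousLinearMap.lsmul ℝ ℝ, volume] K) :=
    hasCompactSupport_radialBump.contDiff_convolution_left _ contDiff_radialBump hKint
  have hconv : ∀ w ∈ ball (0 : Fin 3 → ℝ) 1, k w = (∫ z, radialBump z)⁻¹ •
      (radialBump ⋆[ContinuousLinearMap.lsmul ℝ ℝ, volume] K) w := by
    intro w hw
    have hsum : ∀ z ∈ closedBall (0 : Fin 3 → ℝ) 1, w + z ∈ closedBall (0 : Fin 3 → ℝ) 2 := by
      intro z hz
      rw [mem_closedBall_zero_iff] at hz ⊢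
      rw [mem_ball_zero_iff] at hw
      linarith [norm_add_le w z]
    have h1 := (hmono.comp_affine w 1).integral_radialBump_smul he
      (fun z hz => hsub (by simpa using hsum z hz))
    simp only [one_smul, add_zero] at h1
    rw [eq_inv_smul_iff₀ integral_radialBump_pos.ne', ← h1, convolution_def,
      ← integral_neg_eq_self fun t => ContinuousLinearMap.lsmul ℝ ℝ (radialBump t) (K (w - t))]
    refine integral_congr_ae (Eventually.of_forall fun z => ?_)
    have heven : radialBump (-z) = radialBump z := by simp [radialBump]
    simp only [ContinuousLinearMap.lsmul_apply, sub_neg_eq_add, heven]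
    by_cases hz : z ∈ closedBall (0 : Fin 3 → ℝ) 1
    · rw [hK, indicator_of_mem (hsum z hz)]
    · rw [mem_closedBall_zero_iff, not_le] at hz
      simp [radialBump_eq_zero hz.le]
  have hk0 : ContDiffAt ℝ ∞ k (r⁻¹ • (x - x)) := by
    rw [sub_self, smul_zero]
    refine (hsmooth.const_smul (∫ z, radialBump z)⁻¹).contDiffAt.congr_of_eventuallyEq ?_
    filter_upwards [ball_mem_nhds _ one_pos] with w hw using hconv w hw
  have haff : ContDiffAt ℝ ∞ (fun y : Fin 3 → ℝ => r⁻¹ • (y - x)) x :=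
    ContDiff.contDiffAt (by fun_prop)
  have hcomp := hk0.comp x haff
  refine hcomp.congr_of_eventuallyEq (Eventually.of_forall fun y => ?_)
  simp [hk, smul_smul, hr.ne']

/-- Directional derivatives of monogenic functions are monogenic. -/
lemma Monogenic.fderiv_apply {e : Fin 3 → H} (he : IsCliffordFrame e) {h : (Fin 3 → ℝ) → H}
    {U : Set (Fin 3 → ℝ)} (hU : IsOpen U) (hh : Monogenic e h U) (v : Fin 3 → ℝ) :
    Monogenic e (fun x => fderiv ℝ h x v) U := by
  intro x hx
  have hs : ContDiffAt ℝ 2 h x := contDiffAt_infty.1 (hh.contDiffAt he hU hx) 2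
  have hd : DifferentiableAt ℝ (fderiv ℝ h) x :=
    (hs.fderiv_right (m := 1) one_add_one_eq_two.le).differentiableAt one_ne_zero
  have hdv : ∀ w, HasFDerivAt (fun x => fderiv ℝ h x w)
      ((fderiv ℝ (fderiv ℝ h) x).flip w) x := fun w => by
    simpa using hd.hasFDerivAt.clm_apply (hasFDerivAt_const w x)
  have hsymm : IsSymmSndFDerivAt ℝ h x := hs.isSymmSndFDerivAt (by simp)
  refine ⟨(hdv v).differentiableAt, ?_⟩
  rw [(hdv v).fderiv]
  have hzero : HasFDerivAt (fun y => ∑ k, e k * fderiv ℝ h y (Pi.single k 1))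
      (0 : (Fin 3 → ℝ) →L[ℝ] H) x :=
    (hasFDerivAt_const (0 : H) x).congr_of_eventuallyEq <| by
      filter_upwards [hU.mem_nhds hx] with y hy using (hh y hy).2
  have hsum := HasFDerivAt.fun_sum (u := Finset.univ) fun k _ =>
    ((ContinuousLinearMap.mul ℝ H (e k)).hasFDerivAt).comp x (hdv (Pi.single k 1))
  have := congrArg (fun L => L v) (hsum.unique hzero)
  simpa [hsymm.eq v] using this

/-- Gradient estimate. -/
lemma exists_norm_fderiv_le : ∃ C : ℝ, 0 < C ∧ ∀ (e : Fin 3 → H), IsCliffordFrame e →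
    ∀ (h : (Fin 3 → ℝ) → H) (U : Set (Fin 3 → ℝ)), IsOpen U → Monogenic e h U →
    ∀ (x : Fin 3 → ℝ) (r : ℝ), 0 < r → closedBall x r ⊆ U →
    ∀ M, (∀ y ∈ closedBall x r, ‖h y‖ ≤ M) → ∀ v, ‖fderiv ℝ h x v‖ ≤ C * ‖v‖ / r * M := by
  have hρ : ContDiff ℝ 1 radialBump := contDiff_radialBump (n := 1)
  have hρ' := hρ.continuous_fderiv one_ne_zero
  have hρc := hasCompactSupport_radialBump.fderiv (𝕜 := ℝ)
  have hρi : Integrable fun z => ‖fderiv ℝ radialBump z‖ :=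
    hρ'.norm.integrable_of_hasCompactSupport hρc.norm
  set c := ∫ z, radialBump z
  have hc : 0 < c := integral_radialBump_pos
  set A := ∫ z, ‖fderiv ℝ radialBump z‖
  have hA : 0 ≤ A := integral_nonneg fun _ => norm_nonneg _
  have hunit : ∀ (e : Fin 3 → H), IsCliffordFrame e →
      ∀ (h : (Fin 3 → ℝ) → H) (U : Set (Fin 3 → ℝ)), IsOpen U → Monogenic e h U →
      closedBall 0 1 ⊆ U → ∀ M, (∀ y ∈ closedBall 0 1, ‖h y‖ ≤ M) →
      ∀ v, ‖fderiv ℝ h 0 v‖ ≤ A / c * ‖v‖ * M := by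
    intro e he h U hU hh hsub M hM v
    have hv := hh.fderiv_apply he hU v
    have hint : ∀ {E : Type} [NormedAddCommGroup E] [NormedSpace ℝ E] (w : (Fin 3 → ℝ) → ℝ)
        (k : (Fin 3 → ℝ) → E), Continuous w → tsupport w ⊆ closedBall 0 1 → ContinuousOn k U →
        Integrable fun z => w z • k z := by
      intro E _ _ w k hw hws hk
      have hcs : HasCompactSupport w :=
        (isCompact_closedBall 0 1).of_isClosed_subset (isClosed_tsupport _) hws
      refine Continuous.integrable_of_hasCompactSupport ?_ hcs.smul_right
      exact continuous_of_tsupport fun z hz => hw.continuousAt.smul <|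
        hk.continuousAt (hU.mem_nhds (hsub (hws (tsupport_smul_subset_left w k hz))))
    have hts : tsupport (fun z => fderiv ℝ radialBump z v) ⊆ closedBall 0 1 :=
      (tsupport_fderiv_apply_subset ℝ v).trans tsupport_radialBump_subset
    have hparts := integral_smul_fderiv_eq_neg_fderiv_smul_of_integrable (μ := volume)
      (f := radialBump) (g := h) (v := v)
      (hint _ _ (hρ'.clm_apply continuous_const) hts hh.continuousOn)
      (hint _ _ hρ.continuous tsupport_radialBump_subset hv.continuousOn)
      (hint _ _ hρ.continuous tsupport_radialBump_subset hh.continuousOn)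
      (fun x _ => hρ.differentiable one_ne_zero x)
      (fun x hx => (hh x (hsub (tsupport_radialBump_subset hx))).1)
    rw [hv.integral_radialBump_smul he hsub] at hparts
    have hbound : ‖∫ z, fderiv ℝ radialBump z v • h z‖ ≤
        ∫ z, ‖fderiv ℝ radialBump z‖ * (‖v‖ * M) := by
      refine norm_integral_le_of_norm_le (hρi.mul_const _) (Eventually.of_forall fun z => ?_)
      rw [norm_smul, ← mul_assoc]
      by_cases hz : z ∈ closedBall (0 : Fin 3 → ℝ) 1
      · gcongr
        · exact ContinuousLinearMap.le_opNorm _ _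
        · exact hM z hz
      · have : fderiv ℝ radialBump z = 0 := by
          by_contra h0
          exact hz (tsupport_radialBump_subset (support_fderiv_subset ℝ h0))
        simp [this]
    rw [integral_mul_const, ← norm_neg, ← hparts, norm_smul, Real.norm_of_nonneg hc.le] at hbound
    rw [div_mul_eq_mul_div, div_mul_eq_mul_div, le_div_iff₀ hc]
    linarith
  refine ⟨A / c + 1, by positivity, fun e he h U hU hh x r hr hsub M hM v => ?_⟩
  have hM0 : 0 ≤ M := (norm_nonneg _).trans (hM x (mem_closedBall_self hr.le))
  have hscale : ∀ y ∈ closedBall (0 : Fin 3 → ℝ) 1, x + r • y ∈ closedBall x r := by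
    intro y hy
    rw [mem_closedBall_zero_iff] at hy
    rw [mem_closedBall, dist_self_add_left, norm_smul, Real.norm_of_nonneg hr.le]
    exact mul_le_of_le_one_right hr.le hy
  have h1 := hunit e he (fun z => h (x + r • z)) _
    (hU.preimage (by fun_prop : Continuous fun z : Fin 3 → ℝ => x + r • z)) (hh.comp_affine x r)
    (fun y hy => hsub (hscale y hy)) M (fun y hy => hM _ (hscale y hy)) v
  rw [(hasFDerivAt_comp_affine (by simpa using (hh x (hsub (mem_closedBall_self hr.le))).1)).fderiv,
    smul_zero, add_zero, smul_apply, norm_smul, Real.norm_of_nonneg hr.le] at h1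
  rw [div_mul_eq_mul_div, le_div_iff₀ hr]
  have : 0 ≤ ‖v‖ * M := by positivity
  linarith

/-- A Taylor estimate on `[0, 1]` for a function with vanishing derivatives at `0`. -/
lemma norm_le_of_iterated_hasDerivAt {φ : ℕ → ℝ → H} (hφ0 : ∀ k, φ k 0 = 0)
    (hφ : ∀ k, ∀ t ∈ Icc (0 : ℝ) 1, HasDerivAt (φ k) (φ (k + 1) t) t) (n : ℕ) :
    ∀ (k : ℕ) (B : ℝ), (∀ t ∈ Icc (0 : ℝ) 1, ‖φ (k + n) t‖ ≤ B) →
      ∀ t ∈ Icc (0 : ℝ) 1, ‖φ k t‖ ≤ B * t ^ n / n.factorial := by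
  induction n with
  | zero => intro k B hB t ht; simpa using hB t ht
  | succ n ih =>
    intro k B hB
    have h1 := ih (k + 1) B (by simpa only [add_right_comm, add_assoc, add_comm 1 n] using hB)
    refine image_norm_le_of_norm_deriv_right_le_deriv_boundary
      (f' := φ (k + 1)) (B' := fun t => B * t ^ n / n.factorial)
      (fun t ht => (hφ k t ht).continuousAt.continuousWithinAt)
      (fun t ht => (hφ k t (Ico_subset_Icc_self ht)).hasDerivWithinAt) (by simp [hφ0])
      (fun t => ?_) (fun t ht => h1 t (Ico_subset_Icc_self ht))
    refine (((hasDerivAt_pow (n + 1) t).const_mul B).div_const _).congr_deriv ?_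
    rw [Nat.factorial_succ]
    push_cast
    field_simp

/-- The iterated directional derivative of `h` along `v`. -/
def iterDeriv (v : Fin 3 → ℝ) (k : ℕ) (h : (Fin 3 → ℝ) → H) : (Fin 3 → ℝ) → H :=
  (fun (h : (Fin 3 → ℝ) → H) x => fderiv ℝ h x v)^[k] h

lemma iterDeriv_succ (v : Fin 3 → ℝ) (k : ℕ) (h : (Fin 3 → ℝ) → H) :
    iterDeriv v (k + 1) h = fun x => fderiv ℝ (iterDeriv v k h) x v :=
  Function.iterate_succ_apply' _ _ _

lemma Monogenic.iterDeriv {e : Fin 3 → H} (he : IsCliffordFrame e) {h : (Fin 3 → ℝ) → H}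
    {U : Set (Fin 3 → ℝ)} (hU : IsOpen U) (hh : Monogenic e h U) (v : Fin 3 → ℝ) (k : ℕ) :
    Monogenic e (iterDeriv v k h) U := by
  induction k with
  | zero => exact hh
  | succ k ih => rw [iterDeriv_succ]; exact ih.fderiv_apply he hU v

lemma iterDeriv_eventuallyEq_zero {h : (Fin 3 → ℝ) → H} {x : Fin 3 → ℝ} (hx : h =ᶠ[𝓝 x] 0)
    (v : Fin 3 → ℝ) (k : ℕ) : iterDeriv v k h =ᶠ[𝓝 x] 0 := by
  induction k with
  | zero => exact hx
  | succ k ih =>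
    rw [iterDeriv_succ]
    filter_upwards [ih.fderiv (𝕜 := ℝ)] with y hy
    simp [hy]

/-- A monogenic function vanishing near `x` vanishes on a ball about `x` of definite size. -/
lemma exists_eq_zero_of_eventuallyEq_zero : ∃ κ : ℝ, 0 < κ ∧ κ ≤ 1 ∧
    ∀ (e : Fin 3 → H), IsCliffordFrame e →
    ∀ (h : (Fin 3 → ℝ) → H) (U : Set (Fin 3 → ℝ)), IsOpen U → Monogenic e h U →
    ∀ (x : Fin 3 → ℝ) (R : ℝ), 0 < R → closedBall x (2 * R) ⊆ U → h =ᶠ[𝓝 x] 0 →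
    ∀ y ∈ ball x (κ * R), h y = 0 := by
  obtain ⟨C, hC, hgrad⟩ := exists_norm_fderiv_le
  refine ⟨min 1 (C * Real.exp 1)⁻¹, by positivity, min_le_left _ _,
    fun e he h U hU hh x R hR hsub hx y hy => ?_⟩
  obtain ⟨M, hM⟩ := (isCompact_closedBall x (2 * R)).exists_bound_of_continuousOn
    (hh.continuousOn.mono hsub)
  set v := y - x with hv
  have hvR : ‖v‖ < min 1 (C * Real.exp 1)⁻¹ * R := by rwa [hv, ← dist_eq_norm]
  have hvR1 : ‖v‖ ≤ R := hvR.le.trans (mul_le_of_le_one_left hR.le (min_le_left _ _))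
  have hseg : ∀ t ∈ Icc (0 : ℝ) 1, x + t • v ∈ closedBall x R := by
    intro t ht
    rw [mem_closedBall, dist_self_add_left, norm_smul, Real.norm_of_nonneg ht.1]
    exact (mul_le_of_le_one_left (norm_nonneg _) ht.2).trans hvR1
  have hderiv : ∀ k, ∀ t ∈ Icc (0 : ℝ) 1, HasDerivAt (fun t : ℝ => iterDeriv v k h (x + t • v))
      (iterDeriv v (k + 1) h (x + t • v)) t := by
    intro k t ht
    have hd := ((hh.iterDeriv he hU v k) (x + t • v)
      (hsub (closedBall_subset_closedBall (by linarith) (hseg t ht)))).1.hasFDerivAt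
    have hl : HasDerivAt (fun t : ℝ => x + t • v) v t := by
      simpa using ((hasDerivAt_id t).smul_const v).const_add x
    rw [iterDeriv_succ]
    exact hd.comp_hasDerivAt t hl
  have hbound : ∀ (δ : ℝ), 0 < δ → ∀ k : ℕ, ∀ z ∈ closedBall x (2 * R - k * δ),
      ‖iterDeriv v k h z‖ ≤ (C * ‖v‖ / δ) ^ k * M := by
    intro δ hδ k
    induction k with
    | zero => intro z hz; simpa [iterDeriv] using hM z (by simpa using hz)
    | succ k ih =>
      intro z hz
      have hzsub : closedBall z δ ⊆ closedBall x (2 * R - k * δ) := by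
        refine closedBall_subset_closedBall' ?_
        rw [mem_closedBall] at hz
        push_cast at hz
        linarith
      have hle : closedBall x (2 * R - k * δ) ⊆ U :=
        (closedBall_subset_closedBall
          (by linarith [mul_nonneg (Nat.cast_nonneg (α := ℝ) k) hδ.le])).trans hsub
      have := hgrad e he _ U hU (hh.iterDeriv he hU v k) z δ hδ (hzsub.trans hle) _
        (fun w hw => ih w (hzsub hw)) v
      rw [iterDeriv_succ, pow_succ', mul_assoc]
      exact this
  have hmain : ∀ n : ℕ, n ≠ 0 → ‖h y‖ ≤ (C * Real.exp 1 * ‖v‖ / R) ^ n * M := by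
    intro n hn
    have hM0 : 0 ≤ M := (norm_nonneg _).trans (hM x (mem_closedBall_self (by positivity)))
    have hnpos : (0 : ℝ) < n := by positivity
    have h1 := norm_le_of_iterated_hasDerivAt (φ := fun k t => iterDeriv v k h (x + t • v))
      (fun k => by simpa using (iterDeriv_eventuallyEq_zero hx v k).eq_of_nhds) hderiv n 0
      ((C * ‖v‖ / (R / n)) ^ n * M) (fun t ht => by
        rw [zero_add]
        refine hbound (R / n) (by positivity) n _ ?_
        rw [mul_div_cancel₀ _ hnpos.ne']
        convert hseg t ht using 1
        ring_nf) 1 (by simp)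
    have h2 : (n : ℝ) ^ n / n.factorial ≤ Real.exp 1 ^ n := by
      rw [← Real.exp_nat_mul, mul_one]
      exact Real.pow_div_factorial_le_exp _ (Nat.cast_nonneg _) n
    have h3 : x + (1 : ℝ) • v = y := by simp [hv]
    simp only [h3, one_pow, mul_one] at h1
    calc ‖h y‖ ≤ (C * ‖v‖ / (R / n)) ^ n * M / n.factorial := h1
      _ = (C * ‖v‖ / R) ^ n * M * ((n : ℝ) ^ n / n.factorial) := by
        rw [show C * ‖v‖ / (R / n) = C * ‖v‖ / R * n by field_simp, mul_pow]
        ring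
      _ ≤ (C * ‖v‖ / R) ^ n * M * Real.exp 1 ^ n := by gcongr
      _ = (C * Real.exp 1 * ‖v‖ / R) ^ n * M := by
        rw [show C * Real.exp 1 * ‖v‖ / R = C * ‖v‖ / R * Real.exp 1 by ring, mul_pow]
        ring
  have hlt : C * Real.exp 1 * ‖v‖ / R < 1 := by
    rw [div_lt_one hR]
    have : ‖v‖ < (C * Real.exp 1)⁻¹ * R :=
      hvR.trans_le (mul_le_mul_of_nonneg_right (min_le_right _ _) hR.le)
    rwa [inv_mul_eq_div, lt_div_iff₀' (by positivity)] at this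
  have hlim := (tendsto_pow_atTop_nhds_zero_of_lt_one (by positivity) hlt).mul_const M
  rw [zero_mul] at hlim
  exact norm_le_zero_iff.1 <| ge_of_tendsto hlim <| by
    filter_upwards [eventually_ne_atTop 0] with n hn using hmain n hn

/-- Unique continuation for monogenic functions. -/
lemma Monogenic.eqOn_zero {e : Fin 3 → H} (he : IsCliffordFrame e) {h : (Fin 3 → ℝ) → H}
    {U : Set (Fin 3 → ℝ)} (hU : IsOpen U) (hUc : IsPreconnected U) (hh : Monogenic e h U)
    {x : Fin 3 → ℝ} (hxU : x ∈ U) (hx : h =ᶠ[𝓝 x] 0) : EqOn h 0 U := by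
  obtain ⟨κ, hκ, hκ1, hloc⟩ := exists_eq_zero_of_eventuallyEq_zero
  set Z : Set (Fin 3 → ℝ) := {y | h =ᶠ[𝓝 y] 0} with hZ
  have hZo : IsOpen Z := isOpen_iff_mem_nhds.2 fun y hy => eventually_eventuallyEq_nhds.2 hy
  have hsub : U ⊆ Z := by
    refine hUc.subset_of_closure_inter_subset hZo ⟨x, hxU, hx⟩ ?_
    rintro p ⟨hpZ, hpU⟩
    obtain ⟨ε, hε, hεU⟩ := Metric.isOpen_iff.1 hU p hpU
    set R := ε / 4 with hR
    have hR0 : 0 < R := by positivity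
    obtain ⟨y, hyZ, hpy⟩ := Metric.mem_closure_iff.1 hpZ (κ * R) (by positivity)
    have hκR : κ * R ≤ R := mul_le_of_le_one_left hR0.le hκ1
    have hball : closedBall y (2 * R) ⊆ U := by
      intro z hz
      refine hεU ?_
      rw [mem_closedBall] at hz
      rw [mem_ball]
      rw [dist_comm] at hpy
      linarith [dist_triangle z y p]
    filter_upwards [isOpen_ball.mem_nhds (mem_ball.2 hpy)] with z hz
      using hloc e he h U hU hh y R hR0 hball hyZ z hz
  exact fun y hy => (hsub hy).eq_of_nhds

lemma qi_re : qi.re = 0 := rfl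

lemma qi_imI : qi.imI = 1 := rfl

lemma qi_imJ : qi.imJ = 0 := rfl

lemma qi_imK : qi.imK = 0 := rfl

lemma psi_re {J : H} (hJ : J ∈ S1) (u : ℝ × ℝ × ℝ) : (psi J u).re = u.1 := by
  simp [psi, qi_re, hJ.1]

lemma psi_imI {J : H} (hJ : J ∈ S1) (u : ℝ × ℝ × ℝ) : (psi J u).imI = u.2.1 := by
  simp [psi, qi_imI, hJ.2.1]

lemma psi_imJ (J : H) (u : ℝ × ℝ × ℝ) : (psi J u).imJ = u.2.2 * J.imJ := by
  simp [psi, qi_imJ]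

lemma psi_imK (J : H) (u : ℝ × ℝ × ℝ) : (psi J u).imK = u.2.2 * J.imK := by
  simp [psi, qi_imK]

/-- The coordinates `psi J` on `ℝ³_J`, with domain `Fin 3 → ℝ`. -/
def sliceMap (J : H) (z : Fin 3 → ℝ) : H := psi J (z 0, z 1, z 2)

lemma sliceMap_re {J : H} (hJ : J ∈ S1) (z : Fin 3 → ℝ) : (sliceMap J z).re = z 0 :=
  psi_re hJ _

lemma sliceMap_imI {J : H} (hJ : J ∈ S1) (z : Fin 3 → ℝ) : (sliceMap J z).imI = z 1 :=
  psi_imI hJ _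

lemma sliceMap_imJ (J : H) (z : Fin 3 → ℝ) : (sliceMap J z).imJ = z 2 * J.imJ :=
  psi_imJ J _

lemma sliceMap_imK (J : H) (z : Fin 3 → ℝ) : (sliceMap J z).imK = z 2 * J.imK :=
  psi_imK J _

lemma continuous_sliceMap (J : H) : Continuous (sliceMap J) := by
  unfold sliceMap psi
  have : Continuous fun x : ℝ => (x : H) := Quaternion.continuous_coe
  fun_prop

/-- The coordinates of the orthogonal projection to `ℝ³_J`. -/
def sliceCoord (J x : H) : Fin 3 → ℝ := ![x.re, x.imI, x.imJ * J.imJ + x.imK * J.imK]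

lemma continuous_sliceCoord (J : H) : Continuous (sliceCoord J) := by
  have h0 := Quaternion.continuous_re
  have h1 := Quaternion.continuous_imI
  have h2 := Quaternion.continuous_imJ
  have h3 := Quaternion.continuous_imK
  refine continuous_pi fun i => ?_
  fin_cases i
  · exact h0
  · exact h1
  · exact (h2.mul_const _).add (h3.mul_const _)

lemma sliceCoord_sliceMap {J : H} (hJ : J ∈ S1) (z : Fin 3 → ℝ) :
    sliceCoord J (sliceMap J z) = z := by
  ext i
  fin_cases i
  · simp [sliceCoord, sliceMap_re hJ]
  · simp [sliceCoord, sliceMap_imI hJ]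
  · simp only [sliceCoord, sliceMap_imJ, sliceMap_imK]
    change z 2 * J.imJ * J.imJ + z 2 * J.imK * J.imK = z 2
    linear_combination z 2 * hJ.2.2

lemma sliceMap_mem_hplane (J : H) (z : Fin 3 → ℝ) : sliceMap J z ∈ hplane J :=
  ⟨_, rfl⟩

lemma exists_sliceMap_eq {J x : H} (hx : x ∈ hplane J) : ∃ z, sliceMap J z = x := by
  obtain ⟨u, rfl⟩ := hx
  exact ⟨![u.1, u.2.1, u.2.2], rfl⟩

lemma isPreconnected_preimage_sliceMap {J : H} (hJ : J ∈ S1) {Ω : Set H}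
    (hΩ : IsPreconnected (Ω ∩ hplane J)) : IsPreconnected (sliceMap J ⁻¹' Ω) := by
  convert hΩ.image _ (continuous_sliceCoord J).continuousOn using 1
  ext z
  constructor
  · exact fun hz => ⟨sliceMap J z, ⟨hz, sliceMap_mem_hplane J z⟩, sliceCoord_sliceMap hJ z⟩
  · rintro ⟨x, ⟨hx, hxJ⟩, rfl⟩
    obtain ⟨w, rfl⟩ := exists_sliceMap_eq hxJ
    rwa [sliceCoord_sliceMap hJ]

lemma isCliffordFrame_slice {J : H} (hJ : J ∈ S1) : IsCliffordFrame ![1, qi, J] := by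
  obtain ⟨h0, h1, h2⟩ := hJ
  intro z
  simp only [Fin.sum_univ_three]
  ext <;> simp [qi_re, qi_imI, qi_imJ, qi_imK, h0, h1, -Quaternion.coe_add, -Quaternion.coe_pow]
  · linear_combination z 2 ^ 2 * h2
  all_goals ring

lemma Regular13.monogenic {Ω : Set H} {f g : H → H} (hf : Regular13 f Ω) (hg : Regular13 g Ω)
    {J : H} (hJ : J ∈ S1) :
    Monogenic ![1, qi, J] (fun z => f (sliceMap J z) - g (sliceMap J z)) (sliceMap J ⁻¹' Ω) := by
  intro z hz
  let L : (Fin 3 → ℝ) →L[ℝ] ℝ × ℝ × ℝ := (ContinuousLinearMap.proj 0).prod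
    ((ContinuousLinearMap.proj 1).prod (ContinuousLinearMap.proj 2))
  obtain ⟨hfd, hfe⟩ := hf J hJ (L z) hz
  obtain ⟨hgd, hge⟩ := hg J hJ (L z) hz
  have hd : HasFDerivAt (fun z => f (sliceMap J z) - g (sliceMap J z)) _ z :=
    (hfd.hasFDerivAt.comp z L.hasFDerivAt).sub (hgd.hasFDerivAt.comp z L.hasFDerivAt)
  have hL0 : L (Pi.single 0 1) = (1, 0, 0) := by simp [L]
  have hL1 : L (Pi.single 1 1) = (0, 1, 0) := by simp [L]
  have hL2 : L (Pi.single 2 1) = (0, 0, 1) := by simp [L]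
  refine ⟨hd.differentiableAt, ?_⟩
  rw [hd.fderiv, Fin.sum_univ_three]
  simp only [sub_apply, ContinuousLinearMap.comp_apply, hL0, hL1, hL2]
  have := sub_eq_zero.2 (hfe.trans hge.symm)
  rw [← this]
  simp [mul_sub]
  abel

/-- A monogenic function vanishing on the hyperplane `z 2 = 0` can be cut off along it. -/
lemma Monogenic.indicator {e : Fin 3 → H} (he : IsCliffordFrame e) {h : (Fin 3 → ℝ) → H}
    {U : Set (Fin 3 → ℝ)} (hU : IsOpen U) (hh : Monogenic e h U)
    (h0 : ∀ z ∈ U, z 2 = 0 → h z = 0) : Monogenic e ({z | 0 < z 2}.indicator h) U := by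
  intro z hz
  rcases lt_trichotomy (z 2) 0 with hz2 | hz2 | hz2
  · have hev : {z : Fin 3 → ℝ | 0 < z 2}.indicator h =ᶠ[𝓝 z] fun _ => 0 := by
      filter_upwards [(isOpen_lt (continuous_apply 2) continuous_const).mem_nhds hz2] with w hw
      exact indicator_of_notMem (s := {z : Fin 3 → ℝ | 0 < z 2}) (not_lt.2 (le_of_lt hw)) h
    refine ⟨hev.differentiableAt_iff.2 (differentiableAt_const _), ?_⟩
    simp [hev.fderiv_eq]
  · obtain ⟨hd, hD⟩ := hh z hz
    have htan : ∀ v : Fin 3 → ℝ, v 2 = 0 → fderiv ℝ h z v = 0 := by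
      intro v hv
      have hl : HasDerivAt (fun t : ℝ => z + t • v) v 0 := by
        simpa using ((hasDerivAt_id (0 : ℝ)).smul_const v).const_add z
      have hcomp : HasDerivAt (fun t : ℝ => h (z + t • v)) (fderiv ℝ h z v) 0 :=
        HasFDerivAt.comp_hasDerivAt (0 : ℝ) (by simpa using hd.hasFDerivAt) hl
      refine hcomp.unique ((hasDerivAt_const (0 : ℝ) (0 : H)).congr_of_eventuallyEq ?_)
      have hz0 : z + (0 : ℝ) • v ∈ U := by simpa using hz
      filter_upwards [hl.continuousAt.preimage_mem_nhds (hU.mem_nhds hz0)] with t ht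
      exact h0 _ ht (by simp [hz2, hv])
    have hnormal : fderiv ℝ h z (Pi.single 2 1) = 0 := by
      rw [Fin.sum_univ_three, htan _ (by simp), htan _ (by simp)] at hD
      simp only [mul_zero, zero_add] at hD
      rw [← one_mul (fderiv ℝ h z _), ← he.star_mul_self 2, mul_assoc, hD, mul_zero]
    have hzero : fderiv ℝ h z = 0 := by
      refine ContinuousLinearMap.coe_injective (LinearMap.pi_ext' fun i => ?_)
      ext1
      fin_cases i
      · exact htan _ (by simp)
      · exact htan _ (by simp)
      · exact hnormal
    have hh0 : HasFDerivAt h (0 : (Fin 3 → ℝ) →L[ℝ] H) z := hzero ▸ hd.hasFDerivAt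
    have hk0 : HasFDerivAt ({z : Fin 3 → ℝ | 0 < z 2}.indicator h)
        (0 : (Fin 3 → ℝ) →L[ℝ] H) z := by
      rw [hasFDerivAt_iff_isLittleO] at hh0 ⊢
      refine (Asymptotics.isBigO_of_le _ fun w => ?_).trans_isLittleO hh0
      simpa [h0 z hz hz2, hz2] using norm_indicator_le_norm_self h w
    exact ⟨hk0.differentiableAt, by simp [hk0.fderiv]⟩
  · have hev : {z : Fin 3 → ℝ | 0 < z 2}.indicator h =ᶠ[𝓝 z] h := by
      filter_upwards [(isOpen_lt continuous_const (continuous_apply 2)).mem_nhds hz2] with w hw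
      exact indicator_of_mem (s := {z : Fin 3 → ℝ | 0 < z 2}) hw h
    rw [hev.differentiableAt_iff, hev.fderiv_eq]
    exact hh z hz

/-- Unique continuation from the hyperplane `z 2 = 0`. -/
lemma Monogenic.eqOn_zero_of_hyperplane {e : Fin 3 → H} (he : IsCliffordFrame e)
    {h : (Fin 3 → ℝ) → H} {U : Set (Fin 3 → ℝ)} (hU : IsOpen U) (hUc : IsPreconnected U)
    (hh : Monogenic e h U) (h0 : ∀ z ∈ U, z 2 = 0 → h z = 0) {p : Fin 3 → ℝ} (hp : p ∈ U)
    (hp2 : p 2 = 0) : EqOn h 0 U := by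
  obtain ⟨R, hR, hRU⟩ := Metric.isOpen_iff.1 hU p hp
  have hmem : ∀ t : ℝ, |t| < R → p + Pi.single 2 t ∈ ball p R := by
    intro t ht
    rwa [mem_ball, dist_self_add_left, Pi.norm_single, Real.norm_eq_abs]
  have hlow : p + Pi.single 2 (-(R / 2)) ∈ ball p R :=
    hmem _ (by rw [abs_neg, abs_of_pos] <;> linarith)
  have hup : p + Pi.single 2 (R / 2) ∈ ball p R := hmem _ (by rw [abs_of_pos] <;> linarith)
  have hk := (hh.indicator he hU h0).mono hRU
  have hk0 := hk.eqOn_zero he isOpen_ball (convex_ball p R).isPreconnected hlow <| by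
    have : (p + Pi.single 2 (-(R / 2)) : Fin 3 → ℝ) 2 < 0 := by simp [hp2, hR]
    filter_upwards [(isOpen_lt (continuous_apply 2) continuous_const).mem_nhds this] with w hw
    exact indicator_of_notMem (s := {z : Fin 3 → ℝ | 0 < z 2}) (not_lt.2 (le_of_lt hw)) h
  refine hh.eqOn_zero he hU hUc (hRU hup) ?_
  have : 0 < (p + Pi.single 2 (R / 2) : Fin 3 → ℝ) 2 := by simp [hp2, hR]
  filter_upwards [isOpen_ball.mem_nhds hup,
    (isOpen_lt continuous_const (continuous_apply 2)).mem_nhds this] with w hw hw2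
  rw [← hk0 hw]
  exact (indicator_of_mem (s := {z : Fin 3 → ℝ | 0 < z 2}) hw2 h).symm

lemma exists_mem_hplane (x : H) : ∃ J ∈ S1, x ∈ hplane J := by
  set n := √(x.imJ ^ 2 + x.imK ^ 2)
  have hn2 : n ^ 2 = x.imJ ^ 2 + x.imK ^ 2 := Real.sq_sqrt (by positivity)
  by_cases hn0 : n = 0
  · have hJ : x.imJ = 0 := by nlinarith [sq_nonneg x.imK]
    have hK : x.imK = 0 := by nlinarith [sq_nonneg x.imJ]
    have hqj : qj ∈ S1 := ⟨rfl, rfl, by norm_num [show qj.imJ = 1 from rfl,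
      show qj.imK = 0 from rfl]⟩
    exact ⟨qj, hqj, (x.re, x.imI, 0), by
      ext <;> simp [psi_re hqj, psi_imI hqj, psi_imJ, psi_imK, hJ, hK]⟩
  · have hmem : (⟨0, 0, x.imJ / n, x.imK / n⟩ : H) ∈ S1 := by
      refine ⟨rfl, rfl, ?_⟩
      change (x.imJ / n) ^ 2 + (x.imK / n) ^ 2 = 1
      rw [div_pow, div_pow, ← add_div, ← hn2, div_self (pow_ne_zero 2 hn0)]
    refine ⟨_, hmem, (x.re, x.imI, n),
      Quaternion.ext _ _ (psi_re hmem _) (psi_imI hmem _) ?_ ?_⟩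
    · exact (psi_imJ _ _).trans (mul_div_cancel₀ _ hn0)
    · exact (psi_imK _ _).trans (mul_div_cancel₀ _ hn0)

/-- Identity Principle: if two `(1,3)`-regular functions on a
`(1,3)`-slice domain `Ω` coincide on a subset `S` of some slice `Ω ∩ ℝ³_{J₀}` having
nonempty interior relative to `ℝ³_{J₀}`, then they coincide on all of `Ω`. -/
theorem stmt17 (Ω : Set H) (hΩ : IsSliceDomain13 Ω)
    (f g : H → H) (hf : Regular13 f Ω) (hg : Regular13 g Ω)
    (J₀ : H) (hJ₀ : J₀ ∈ S1) (S : Set H) (hS : S ⊆ Ω ∩ hplane J₀)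
    (hint : ∃ U : Set (ℝ × ℝ × ℝ), IsOpen U ∧ U.Nonempty ∧ ∀ u ∈ U, psi J₀ u ∈ S)
    (heq : Set.EqOn f g S) :
    Set.EqOn f g Ω := by
  obtain ⟨hΩo, -, ⟨p, hpΩ, hpJ, hpK⟩, hΩc⟩ := hΩ
  have hopen : ∀ J, IsOpen (sliceMap J ⁻¹' Ω) := fun J => hΩo.preimage (continuous_sliceMap J)
  have hconn : ∀ J ∈ S1, IsPreconnected (sliceMap J ⁻¹' Ω) := fun J hJ =>
    isPreconnected_preimage_sliceMap hJ (hΩc J hJ).isPreconnected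
  have hmirror : ∀ x ∈ Ω ∩ Cset, f x = g x := by
    rintro x ⟨hx, hxJ, hxK⟩
    obtain ⟨V, hV, ⟨u, hu⟩, hVS⟩ := hint
    have hcont : Continuous fun z : Fin 3 → ℝ => (z 0, z 1, z 2) := by fun_prop
    have hmem : ![u.1, u.2.1, u.2.2] ∈ (fun z : Fin 3 → ℝ => (z 0, z 1, z 2)) ⁻¹' V := hu
    have hzero := (hf.monogenic hg hJ₀).eqOn_zero (isCliffordFrame_slice hJ₀) (hopen J₀)
      (hconn J₀ hJ₀) (x := ![u.1, u.2.1, u.2.2]) (hS (hVS u hu)).1 <| by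
        filter_upwards [(hV.preimage hcont).mem_nhds hmem] with z hz
        exact sub_eq_zero.2 (heq (hVS _ hz))
    have hxz : sliceMap J₀ ![x.re, x.imI, 0] = x := by
      ext <;> simp [sliceMap_re hJ₀, sliceMap_imI hJ₀, sliceMap_imJ, sliceMap_imK, hxJ, hxK]
    have := hzero (x := ![x.re, x.imI, 0]) (by rwa [mem_preimage, hxz])
    rw [← hxz]
    exact sub_eq_zero.1 this
  intro x hx
  obtain ⟨J, hJ, hxJ⟩ := exists_mem_hplane x
  obtain ⟨z, rfl⟩ := exists_sliceMap_eq hxJ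
  have hpz : sliceMap J ![p.re, p.imI, 0] = p := by
    ext <;> simp [sliceMap_re hJ, sliceMap_imI hJ, sliceMap_imJ, sliceMap_imK, hpJ, hpK]
  refine sub_eq_zero.1 <| (hf.monogenic hg hJ).eqOn_zero_of_hyperplane (isCliffordFrame_slice hJ)
    (hopen J) (hconn J hJ) (fun w hw hw2 => sub_eq_zero.2 <| hmirror _ ⟨hw, ?_, ?_⟩)
    (p := ![p.re, p.imI, 0]) (by rwa [mem_preimage, hpz]) rfl hx
  · rw [sliceMap_imJ, hw2, zero_mul]
  · rw [sliceMap_imK, hw2, zero_mul]
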